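/- arXiv:2206.02258 — 4 statements merged into one kernel-verified Lean document; each statement's English description precedes it below -/
import Mathlib

section
/- Let f : ℝ^d → (0,∞] be a radial decreasing density. Then for every n ∈ ℕ and every x ∈ ℝ^d with |x| ≥ 1 one has f^{n⋆}(x)/f(x) ≥ max(g_n(x), M₁^{n−1}), where M₁ := f(1,0,…,0)·|B_{1/2}(0)|. -/
open MeasureTheory Filter Topology ENNReal Set

noncomputable section

/-- `iterConv f n` is the `(n+1)`-fold convolution `f^{(n+1)⋆}`:
`iterConv f 0 = f` and `iterConv f (n+1) x = ∫ f(x-y) iterConv f n y dy`. -/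
def iterConv {d : ℕ} (f : EuclideanSpace ℝ (Fin d) → ℝ≥0∞) :
    ℕ → EuclideanSpace ℝ (Fin d) → ℝ≥0∞
  | 0 => f
  | n + 1 => fun x => ∫⁻ y, f (x - y) * iterConv f n y

/-- The set `E(x) = {z : |z| < |x|, |x - z| < |x|}`. -/
def Eset {d : ℕ} (x : EuclideanSpace ℝ (Fin d)) : Set (EuclideanSpace ℝ (Fin d)) :=
  {z | ‖z‖ < ‖x‖ ∧ ‖x - z‖ < ‖x‖}

/-- `gfun f n` is the function `g_{n+1}`: `g₁ ≡ 1` and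
`g_{n+1}(x) = (∫_{E(x)} f(x-y) f(y) g_n(y) dy) / f(x)`.
(In `ℝ≥0∞`, `a / ∞ = 0` and the integral over the empty set is `0`.) -/
def gfun {d : ℕ} (f : EuclideanSpace ℝ (Fin d) → ℝ≥0∞) :
    ℕ → EuclideanSpace ℝ (Fin d) → ℝ≥0∞
  | 0 => fun _ => 1
  | n + 1 => fun x => (∫⁻ y in Eset x, f (x - y) * f y * gfun f n y) / f x

theorem aux_g {d : ℕ} (f : EuclideanSpace ℝ (Fin d) → ℝ≥0∞) (n : ℕ) :
    ∀ x, f x * gfun f n x ≤ iterConv f n x := by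
  induction n with
  | zero => intro x; simp [gfun, iterConv]
  | succ n ih =>
    intro x
    simp only [gfun, iterConv]
    refine ENNReal.mul_div_le.trans ?_
    refine (setLIntegral_le_lintegral _ _).trans (lintegral_mono fun y => ?_)
    rw [mul_assoc]
    exact mul_le_mul_right (ih y) _

theorem aux_center {d : ℕ} (x : EuclideanSpace ℝ (Fin d)) :
    ∃ c : EuclideanSpace ℝ (Fin d), ∀ y ∈ Metric.ball c (1 / 2),
      ‖x - y‖ ≤ 1 ∧ ‖y‖ ≤ max ‖x‖ 1 := by
  have key : ∃ c : EuclideanSpace ℝ (Fin d), ‖x - c‖ ≤ 1 / 2 ∧ ‖c‖ + 1 / 2 ≤ max ‖x‖ 1 := by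
    rcases le_total 1 ‖x‖ with h | h
    · have hx : 0 < ‖x‖ := by linarith
      refine ⟨(1 - 1 / (2 * ‖x‖)) • x, ?_, ?_⟩
      · have : x - (1 - 1 / (2 * ‖x‖)) • x = (1 / (2 * ‖x‖)) • x := by module
        rw [this, norm_smul, Real.norm_of_nonneg (by positivity)]
        field_simp
        rfl
      · have h1 : 1 / (2 * ‖x‖) ≤ 1 := by
          rw [div_le_one (by positivity)]; linarith
        rw [norm_smul, Real.norm_of_nonneg (by linarith)]
        refine le_trans (le_of_eq ?_) (le_max_left _ _)
        field_simp
        ring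
    · refine ⟨(1 / 2 : ℝ) • x, ?_, ?_⟩
      · have : x - (1 / 2 : ℝ) • x = (1 / 2 : ℝ) • x := by module
        rw [this, norm_smul, Real.norm_of_nonneg (by norm_num)]
        linarith
      · rw [norm_smul, Real.norm_of_nonneg (by norm_num)]
        refine le_trans ?_ (le_max_right _ _)
        linarith
  obtain ⟨c, h1, h2⟩ := key
  refine ⟨c, fun y hy => ?_⟩
  rw [mem_ball_iff_norm] at hy
  constructor
  · have : x - y = (x - c) - (y - c) := by abel
    rw [this]
    exact (norm_sub_le _ _).trans (by linarith)
  · have : y = c + (y - c) := by abel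
    rw [this]
    exact (norm_add_le _ _).trans (by linarith)

theorem aux_M {d : ℕ} (f : EuclideanSpace ℝ (Fin d) → ℝ≥0∞)
    (q : ℝ → ℝ≥0∞) (hq : Antitone q) (hfq : ∀ x, f x = q ‖x‖) (n : ℕ) :
    ∀ x, (q 1 * volume (Metric.ball (0 : EuclideanSpace ℝ (Fin d)) (1 / 2))) ^ n *
      q (max ‖x‖ 1) ≤ iterConv f n x := by
  induction n with
  | zero =>
    intro x
    simp only [pow_zero, one_mul, iterConv, hfq]
    exact hq (le_max_left _ _)
  | succ n ih =>
    intro x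
    obtain ⟨c, hc⟩ := aux_center x
    set V := volume (Metric.ball (0 : EuclideanSpace ℝ (Fin d)) (1 / 2)) with hV
    have hVc : volume (Metric.ball c (1 / 2)) = V := by
      rw [hV, Measure.addHaar_ball_center]
    calc (q 1 * V) ^ (n + 1) * q (max ‖x‖ 1)
        = (q 1 * ((q 1 * V) ^ n * q (max ‖x‖ 1))) * V := by ring
      _ = ∫⁻ y in Metric.ball c (1 / 2), q 1 * ((q 1 * V) ^ n * q (max ‖x‖ 1)) := by
          rw [setLIntegral_const, hVc]
      _ ≤ ∫⁻ y in Metric.ball c (1 / 2), f (x - y) * iterConv f n y := by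
          refine setLIntegral_mono' Metric.isOpen_ball.measurableSet fun y hy => ?_
          obtain ⟨h1, h2⟩ := hc y hy
          refine mul_le_mul' ?_ (le_trans (mul_le_mul' le_rfl ?_) (ih y))
          · rw [hfq]; exact hq h1
          · exact hq (max_le h2 (le_max_right _ _))
      _ ≤ iterConv f (n + 1) x := setLIntegral_le_lintegral _ _

theorem aux_fin {d : ℕ} (f : EuclideanSpace ℝ (Fin d) → ℝ≥0∞)
    (hint : ∫⁻ x, f x ≠ ⊤)
    (q : ℝ → ℝ≥0∞) (hq : Antitone q) (hfq : ∀ x, f x = q ‖x‖)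
    (x : EuclideanSpace ℝ (Fin d)) (hx : 1 ≤ ‖x‖) : f x ≠ ⊤ := by
  intro h
  apply hint
  rw [eq_top_iff]
  have hp : volume (Metric.ball (0 : EuclideanSpace ℝ (Fin d)) 1) ≠ 0 :=
    (Metric.measure_ball_pos volume _ one_pos).ne'
  calc (⊤ : ℝ≥0∞) = ∫⁻ y in Metric.ball (0 : EuclideanSpace ℝ (Fin d)) 1, ⊤ := by
        rw [setLIntegral_const, ENNReal.top_mul hp]
    _ ≤ ∫⁻ y in Metric.ball (0 : EuclideanSpace ℝ (Fin d)) 1, f y := by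
        refine setLIntegral_mono' Metric.isOpen_ball.measurableSet fun y hy => ?_
        rw [mem_ball_zero_iff] at hy
        rw [← h, hfq, hfq]
        exact hq (by linarith)
    _ ≤ _ := setLIntegral_le_lintegral _ _

/-- Let `f : ℝ^d → (0,∞]` be a radial decreasing density. Then for every
`n ≥ 1` (written here as `n+1`, `n : ℕ`) and every `x` with `|x| ≥ 1`,
`f^{(n+1)⋆}(x)/f(x) ≥ max (g_{n+1}(x)) (M₁^n)` where
`M₁ = f(1,0,…,0) · |B_{1/2}(0)|`. -/
theorem stmt0 (d : ℕ) (hd : 0 < d) (f : EuclideanSpace ℝ (Fin d) → ℝ≥0∞)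
    (hmeas : Measurable f) (hpos : ∀ x, 0 < f x) (hint : ∫⁻ x, f x ≠ ⊤)
    (q : ℝ → ℝ≥0∞) (hq : Antitone q) (hfq : ∀ x, f x = q ‖x‖)
    (M₁ : ℝ≥0∞)
    (hM₁ : M₁ = f (EuclideanSpace.single (⟨0, hd⟩ : Fin d) (1 : ℝ)) *
      volume (Metric.ball (0 : EuclideanSpace ℝ (Fin d)) (1 / 2))) :
    ∀ (n : ℕ) (x : EuclideanSpace ℝ (Fin d)), 1 ≤ ‖x‖ →
      gfun f n x ⊔ M₁ ^ n ≤ iterConv f n x / f x := by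
  intro n x hx
  have h0 := (hpos x).ne'
  have ht := aux_fin f hint q hq hfq x hx
  rw [ENNReal.le_div_iff_mul_le (Or.inl h0) (Or.inl ht)]
  rcases le_total (gfun f n x) (M₁ ^ n) with h | h
  · rw [sup_of_le_right h]
    have := aux_M f q hq hfq n x
    rw [max_eq_left hx, ← hfq] at this
    rw [hM₁, hfq (EuclideanSpace.single _ _)]
    simpa using this
  · rw [sup_of_le_left h, mul_comm]
    exact aux_g f n x
end
end

section
/- Let f satisfy Assumption (A). Then for every x ∈ ℝ^d and every n ∈ ℕ one has f^{n⋆}(x) ≤ (∑_{i=1}^n binom(n,i) M₂^{n−i} h_i(x)) · f(x), where M₂ := (C₁ ∨ C₂)·‖f‖₁ and C₁, C₂ are the constants from Assumption (A). -/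
open MeasureTheory Filter Topology ENNReal Set

noncomputable section

/-- The set `D(x) = {z : |z| < |x| - 1, |x - z| < |x| - 1}`. -/
def Dset {d : ℕ} (x : EuclideanSpace ℝ (Fin d)) : Set (EuclideanSpace ℝ (Fin d)) :=
  {z | ‖z‖ < ‖x‖ - 1 ∧ ‖x - z‖ < ‖x‖ - 1}

/-- `hfun f n` is the function `h_{n+1}`: `h₁ ≡ 1` and
`h_{n+1}(x) = (∫_{D(x)} f(x-y) f(y) h_n(y) dy) / f(x)`. -/
def hfun {d : ℕ} (f : EuclideanSpace ℝ (Fin d) → ℝ≥0∞) :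
    ℕ → EuclideanSpace ℝ (Fin d) → ℝ≥0∞
  | 0 => fun _ => 1
  | n + 1 => fun x => (∫⁻ y in Dset x, f (x - y) * f y * hfun f n y) / f x

lemma rearr {a b c e : ℝ≥0∞} (h1 : b ≤ a) (h2 : e ≤ c) : b * c + a * e ≤ a * c + b * e := by
  obtain ⟨s, rfl⟩ := exists_add_of_le h1
  obtain ⟨t, rfl⟩ := exists_add_of_le h2
  calc b * (e + t) + (b + s) * e ≤ (b * (e + t) + (b + s) * e) + s * t := le_self_add
    _ = (b + s) * (e + t) + b * e := by ring

lemma conv_anti {d : ℕ} (f g : EuclideanSpace ℝ (Fin d) → ℝ≥0∞)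
    (hf : Measurable f) (hg : Measurable g)
    (hfa : ∀ u v, ‖u‖ ≤ ‖v‖ → f v ≤ f u) (hga : ∀ u v, ‖u‖ ≤ ‖v‖ → g v ≤ g u)
    (x x' : EuclideanSpace ℝ (Fin d)) (hx : ‖x‖ ≤ ‖x'‖) :
    ∫⁻ y, f (x' - y) * g y ≤ ∫⁻ y, f (x - y) * g y := by
  obtain ⟨m, p, rfl, rfl⟩ : ∃ m p, x = m + p ∧ x' = m - p := by
    refine ⟨(2⁻¹ : ℝ) • (x + x'), (2⁻¹ : ℝ) • (x - x'), ?_, ?_⟩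
    · module
    · module
  have hmp : inner ℝ m p ≤ 0 := by
    have h1 := norm_add_sq_real m p
    have h2 := norm_sub_sq_real m p
    have h3 : ‖m + p‖ ^ 2 ≤ ‖m - p‖ ^ 2 := by gcongr
    linarith
  have e1 : ∀ w, ∫⁻ y, f (m + w - y) * g y = ∫⁻ u, f (w - u) * g (m + u) := by
    intro w
    rw [← lintegral_add_left_eq_self _ m]
    congr 1; ext u; congr 2; abel
  rw [sub_eq_add_neg, e1, e1]
  set R := (ℝ ∙ p)ᗮ.reflection with hR
  have hRm : MeasurePreserving R := R.measurePreserving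
  have hRp : R p = -p := Submodule.reflection_orthogonalComplement_singleton_eq_neg p
  have hRR : ∀ u, R (R u) = u := fun u => Submodule.reflection_reflection _ u
  have e2 : ∀ F : EuclideanSpace ℝ (Fin d) → ℝ≥0∞, Measurable F →
      ∫⁻ u, (F u + F (R u)) = 2 * ∫⁻ u, F u := by
    intro F hF
    rw [lintegral_add_left hF, hRm.lintegral_comp hF, two_mul]
  have key : 2 * ∫⁻ u, f (-p - u) * g (m + u) ≤ 2 * ∫⁻ u, f (p - u) * g (m + u) := by
    rw [← e2 _ (by fun_prop), ← e2 _ (by fun_prop)]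
    refine lintegral_mono fun u => ?_
    have n1 : ‖-p - R u‖ = ‖p - u‖ := by
      rw [← hRp, ← map_sub, R.norm_map]
    have n2 : ‖p - R u‖ = ‖-p - u‖ := by
      rw [← R.norm_map (p - R u), map_sub, hRR, hRp]
    have f1 : f (-p - R u) = f (p - u) := le_antisymm (hfa _ _ n1.ge) (hfa _ _ n1.le)
    have f2 : f (p - R u) = f (-p - u) := le_antisymm (hfa _ _ n2.ge) (hfa _ _ n2.le)
    simp only [f1, f2]
    have i1 : ‖-p - u‖ ^ 2 - ‖p - u‖ ^ 2 = 4 * inner ℝ p u := by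
      have h1 := norm_sub_sq_real p u
      have h2 := norm_sub_sq_real (-p) u
      rw [inner_neg_left, norm_neg] at h2
      linarith
    have i2 : ∃ c : ℝ, R u = u - (c * inner ℝ p u) • p ∧ 0 ≤ c := by
      refine ⟨2 / ‖p‖ ^ 2, ?_, by positivity⟩
      rw [hR, Submodule.reflection_orthogonal_apply, Submodule.reflection_singleton_apply]
      simp only [RCLike.ofReal_real_eq_id, id]
      module
    obtain ⟨c, hc, hc0⟩ := i2
    have i3 : ‖m + R u‖ ^ 2 - ‖m + u‖ ^ 2 = -(2 * c * inner ℝ p u * inner ℝ m p) := by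
      have h1 := norm_add_sq_real m u
      have h2 := norm_add_sq_real m (R u)
      rw [R.norm_map] at h2
      have h3 : inner ℝ m (R u) = inner ℝ m u - c * inner ℝ p u * inner ℝ m p := by
        rw [hc, inner_sub_right, inner_smul_right]
      rw [h3] at h2
      linarith
    have sq : ∀ a b : EuclideanSpace ℝ (Fin d), 0 ≤ ‖b‖ ^ 2 - ‖a‖ ^ 2 → ‖a‖ ≤ ‖b‖ :=
      fun a b h => (sq_le_sq₀ (norm_nonneg a) (norm_nonneg b)).1 (by linarith)
    rcases le_total 0 (inner ℝ p u) with h | h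
    · apply rearr
      · exact hfa _ _ (sq _ _ (by rw [i1]; positivity))
      · refine hga _ _ (sq _ _ ?_)
        rw [i3]
        have := mul_nonneg (mul_nonneg hc0 h) (neg_nonneg.2 hmp)
        nlinarith
    · rw [add_comm, add_comm (f (p - u) * g (m + u))]
      apply rearr
      · exact hfa _ _ (sq _ _ (by linarith))
      · refine hga _ _ (sq _ _ ?_)
        have := mul_nonneg (mul_nonneg hc0 (neg_nonneg.2 h)) (neg_nonneg.2 hmp)
        nlinarith
  exact (ENNReal.mul_le_mul_iff_right (by simp) (by simp)).1 key

lemma iterConv_meas {d : ℕ} (f : EuclideanSpace ℝ (Fin d) → ℝ≥0∞) (hf : Measurable f) (n : ℕ) :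
    Measurable (iterConv f n) := by
  induction n with
  | zero => exact hf
  | succ n ih =>
    exact Measurable.lintegral_prod_right' (f := fun z : EuclideanSpace ℝ (Fin d) ×
      EuclideanSpace ℝ (Fin d) => f (z.1 - z.2) * iterConv f n z.2) (by fun_prop)

lemma iterConv_anti {d : ℕ} (f : EuclideanSpace ℝ (Fin d) → ℝ≥0∞) (hf : Measurable f)
    (hfa : ∀ u v, ‖u‖ ≤ ‖v‖ → f v ≤ f u) (n : ℕ) :
    ∀ u v, ‖u‖ ≤ ‖v‖ → iterConv f n v ≤ iterConv f n u := by
  induction n with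
  | zero => exact hfa
  | succ n ih => exact fun u v h => conv_anti f _ hf (iterConv_meas f hf n) hfa ih u v h

lemma iterConv_int {d : ℕ} (f : EuclideanSpace ℝ (Fin d) → ℝ≥0∞) (hf : Measurable f) (n : ℕ) :
    ∫⁻ x, iterConv f n x = (∫⁻ x, f x) ^ (n + 1) := by
  induction n with
  | zero => simp [iterConv]
  | succ n ih =>
    have hm := iterConv_meas f hf n
    simp only [iterConv]
    rw [lintegral_lintegral_swap (by fun_prop)]
    have : ∀ y, ∫⁻ x, f (x - y) * iterConv f n y = (∫⁻ x, f x) * iterConv f n y := by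
      intro y
      rw [lintegral_mul_const _ (by fun_prop), lintegral_sub_right_eq_self]
    simp only [this]
    rw [lintegral_const_mul _ hm, ih]
    ring

lemma Dset_meas {d : ℕ} (x : EuclideanSpace ℝ (Fin d)) : MeasurableSet (Dset x) := by
  unfold Dset
  rw [setOf_and]
  apply MeasurableSet.inter
  · apply measurableSet_lt <;> fun_prop
  · apply measurableSet_lt <;> fun_prop

lemma hfun_meas {d : ℕ} (f : EuclideanSpace ℝ (Fin d) → ℝ≥0∞) (hf : Measurable f) (n : ℕ) :
    Measurable (hfun f n) := by
  induction n with
  | zero => exact measurable_const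
  | succ n ih =>
    refine Measurable.div ?_ hf
    simp_rw [← lintegral_indicator (Dset_meas _)]
    have hS : MeasurableSet {z : EuclideanSpace ℝ (Fin d) × EuclideanSpace ℝ (Fin d) |
        ‖z.2‖ < ‖z.1‖ - 1 ∧ ‖z.1 - z.2‖ < ‖z.1‖ - 1} := by
      rw [setOf_and]
      apply MeasurableSet.inter
      · apply measurableSet_lt <;> fun_prop
      · apply measurableSet_lt <;> fun_prop
    have := Measurable.lintegral_prod_right' (ν := volume) (Measurable.indicator (f := fun z :
      EuclideanSpace ℝ (Fin d) × EuclideanSpace ℝ (Fin d) =>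
        f (z.1 - z.2) * f z.2 * hfun f n z.2) (by fun_prop) hS)
    exact this

lemma exists_z {d : ℕ} (f : EuclideanSpace ℝ (Fin d) → ℝ≥0∞)
    (hfa : ∀ u v, ‖u‖ ≤ ‖v‖ → f v ≤ f u)
    (C₁ C₂ : ℝ) (hC₁ : 1 ≤ C₁)
    (hC1f : ∀ x y : EuclideanSpace ℝ (Fin d), 1 ≤ ‖x‖ → ‖x‖ ≤ ‖y‖ → ‖y‖ ≤ ‖x‖ + 1 →
      f x ≤ ENNReal.ofReal C₁ * f y)
    (hC2f : ∀ x : EuclideanSpace ℝ (Fin d), ‖x‖ ≤ 1 → f x ≤ ENNReal.ofReal C₂ * f ((2 : ℝ) • x))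
    (x : EuclideanSpace ℝ (Fin d)) :
    ∃ z, f z ≤ ENNReal.ofReal (max C₁ C₂) * f x ∧
      (∀ y, y ∈ Dset x ∨ ‖z‖ ≤ ‖y‖ ∨ ‖z‖ ≤ ‖x - y‖) ∧
      (∀ y ∈ Dset z, y ∈ Dset x ∧ f (z - y) ≤ ENNReal.ofReal (max C₁ C₂) * f (x - y)) := by
  have hC1f' : ∀ x y : EuclideanSpace ℝ (Fin d), 1 ≤ ‖x‖ → ‖y‖ ≤ ‖x‖ + 1 →
      f x ≤ ENNReal.ofReal (max C₁ C₂) * f y := by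
    intro a b h1 h2
    rcases le_total ‖a‖ ‖b‖ with h | h
    · refine (hC1f a b h1 h h2).trans ?_
      gcongr
      exact le_max_left _ _
    · refine (hfa _ _ h).trans (le_mul_of_one_le_left' ?_)
      rw [ENNReal.one_le_ofReal]
      exact hC₁.trans (le_max_left _ _)
  rcases le_total 2 ‖x‖ with h | h
  · have hx0 : ‖x‖ ≠ 0 := by linarith
    have hxz : ‖x - (1 - 1 / ‖x‖) • x‖ = 1 := by
      have : x - (1 - 1 / ‖x‖) • x = (1 / ‖x‖) • x := by module
      rw [this, norm_smul, norm_div, norm_norm, norm_one]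
      field_simp
    have hz : ‖(1 - 1 / ‖x‖) • x‖ = ‖x‖ - 1 := by
      rw [norm_smul, Real.norm_of_nonneg]
      · field_simp
      · have : 1 / ‖x‖ ≤ 1 := by rw [div_le_one (by linarith)]; linarith
        linarith
    refine ⟨(1 - 1 / ‖x‖) • x, ?_⟩
    generalize (1 - 1 / ‖x‖) • x = z at hxz hz
    refine ⟨hC1f' _ _ (by linarith) (by linarith), ?_, ?_⟩
    · intro y
      by_contra! hh
      refine hh.1 ⟨?_, ?_⟩ <;> linarith
    · rintro y ⟨h1, h2⟩
      have t1 : ‖x - y‖ ≤ ‖x - z‖ + ‖z - y‖ := norm_sub_le_norm_sub_add_norm_sub x z y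
      have t2 : ‖z‖ ≤ ‖z - y‖ + ‖y‖ := by
        have := norm_add_le (z - y) y
        rwa [sub_add_cancel] at this
      refine ⟨⟨by linarith, by linarith⟩, hC1f' _ _ (by linarith) (by linarith)⟩
  · have hz : ‖(2⁻¹ : ℝ) • x‖ = ‖x‖ / 2 := by
      rw [norm_smul]; norm_num; ring
    refine ⟨(2⁻¹ : ℝ) • x, ?_, ?_, ?_⟩
    · refine (hC2f _ (by linarith)).trans ?_
      rw [smul_smul]
      norm_num
      gcongr
      exact le_max_right _ _
    · intro y
      right
      have t2 : ‖x‖ ≤ ‖x - y‖ + ‖y‖ := by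
        have := norm_add_le (x - y) y
        rwa [sub_add_cancel] at this
      by_contra! hh
      linarith [hh.1, hh.2]
    · rintro y ⟨h1, h2⟩
      linarith [norm_nonneg y]

lemma hfun_mul {d : ℕ} (f : EuclideanSpace ℝ (Fin d) → ℝ≥0∞) (x : EuclideanSpace ℝ (Fin d))
    (h0 : f x ≠ 0) (ht : f x ≠ ⊤) (j : ℕ) :
    hfun f (j + 1) x * f x = ∫⁻ y in Dset x, f (x - y) * f y * hfun f j y := by
  simp only [hfun]
  exact ENNReal.div_mul_cancel h0 ht

lemma hfun_z {d : ℕ} (f : EuclideanSpace ℝ (Fin d) → ℝ≥0∞) (hf : Measurable f)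
    (x z : EuclideanSpace ℝ (Fin d)) (hpos : ∀ x, 0 < f x) (ht : f x ≠ ⊤)
    (C : ℝ≥0∞) (hC : C ≠ ⊤) (h1 : f z ≤ C * f x)
    (h3 : ∀ y ∈ Dset z, y ∈ Dset x ∧ f (z - y) ≤ C * f (x - y)) (j : ℕ) :
    hfun f j z * f z ≤ C * (hfun f j x * f x) := by
  cases j with
  | zero => simpa [hfun] using h1
  | succ j =>
    have hm := hfun_meas f hf j
    rw [hfun_mul f x (hpos x).ne' ht, hfun_mul f z (hpos z).ne'
      (h1.trans_lt (ENNReal.mul_lt_top hC.lt_top ht.lt_top)).ne, ← lintegral_const_mul _ (by fun_prop)]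
    calc _ ≤ ∫⁻ y in Dset z, C * (f (x - y) * f y * hfun f j y) := by
          refine setLIntegral_mono (by fun_prop) fun y hy => ?_
          rw [← mul_assoc, ← mul_assoc]
          gcongr
          exact (h3 y hy).2
      _ ≤ _ := lintegral_mono_set fun y hy => (h3 y hy).1

/-- Under Assumption (A), for every `n ≥ 1` (written `n+1`) and every `x`,
`f^{(n+1)⋆}(x) ≤ (∑_{i=1}^{n+1} binom(n+1,i) M₂^{n+1-i} h_i(x)) · f(x)`,
where `M₂ = (C₁ ∨ C₂)·‖f‖₁`. -/
theorem stmt1 (d : ℕ) (hd : 0 < d) (f : EuclideanSpace ℝ (Fin d) → ℝ≥0∞)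
    (hmeas : Measurable f) (hpos : ∀ x, 0 < f x) (hint : ∫⁻ x, f x ≠ ⊤)
    (q : ℝ → ℝ≥0∞) (hq : Antitone q) (hfq : ∀ x, f x = q ‖x‖)
    (C₁ C₂ : ℝ) (hC₁ : 1 ≤ C₁) (hC₂ : 1 ≤ C₂)
    (hC1f : ∀ x y : EuclideanSpace ℝ (Fin d), 1 ≤ ‖x‖ → ‖x‖ ≤ ‖y‖ → ‖y‖ ≤ ‖x‖ + 1 →
      f x ≤ ENNReal.ofReal C₁ * f y)
    (hC2f : ∀ x : EuclideanSpace ℝ (Fin d), ‖x‖ ≤ 1 → f x ≤ ENNReal.ofReal C₂ * f ((2 : ℝ) • x))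
    (M₂ : ℝ) (hM₂ : M₂ = max C₁ C₂ * (∫⁻ y, f y).toReal) :
    ∀ (n : ℕ) (x : EuclideanSpace ℝ (Fin d)),
      iterConv f n x ≤
        (∑ j ∈ Finset.range (n + 1),
          ((n + 1).choose (j + 1) : ℝ≥0∞) * ENNReal.ofReal M₂ ^ (n - j) * hfun f j x) * f x := by
  have hfa : ∀ u v, ‖u‖ ≤ ‖v‖ → f v ≤ f u := fun u v h => by
    rw [hfq, hfq]; exact hq h
  set C := ENNReal.ofReal (max C₁ C₂) with hC
  set N := ∫⁻ x, f x with hN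
  have hM : ENNReal.ofReal M₂ = C * N := by
    rw [hM₂, ENNReal.ofReal_mul (by positivity), ENNReal.ofReal_toReal hint]
  have hC1 : 1 ≤ C := by
    rw [hC, ENNReal.one_le_ofReal]; exact hC₁.trans (le_max_left _ _)
  have hN0 : N ≠ 0 := by
    intro h
    rw [hN, lintegral_eq_zero_iff hmeas] at h
    obtain ⟨x, hx⟩ := h.exists
    exact (hpos x).ne' hx
  have hM0 : C * N ≠ 0 := mul_ne_zero (by positivity) hN0
  rw [hM]
  generalize hMM : C * N = M at hM0
  intro n
  induction n with
  | zero => intro x; simp [iterConv, hfun]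
  | succ n ih =>
    intro x
    by_cases ht : f x = ⊤
    · rw [ht, ENNReal.mul_top]
      · exact le_top
      · intro h
        rw [Finset.sum_eq_zero_iff] at h
        have := h 0 (by simp)
        simp only [hfun, mul_one, mul_eq_zero] at this
        rcases this with h | h
        · simp at h
        · exact pow_ne_zero _ hM0 h
    obtain ⟨z, hz1, hz2, hz3⟩ := exists_z f hfa C₁ C₂ hC₁ hC1f hC2f x
    rw [← hC] at hz1 hz3
    have hzj := hfun_z f hmeas x z hpos ht C ENNReal.ofReal_ne_top hz1 hz3
    have hcm := iterConv_meas f hmeas n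
    have hhm := hfun_meas f hmeas
    have hfx : ∫⁻ y, f (x - y) = N := lintegral_sub_left_eq_self f x
    have p1 : ∫⁻ y in Dset x, f (x - y) * iterConv f n y ≤
        ∑ j ∈ Finset.range (n + 1),
          ((n + 1).choose (j + 1) : ℝ≥0∞) * M ^ (n - j) * (hfun f (j + 1) x * f x) := by
      calc _ ≤ ∫⁻ y in Dset x, ∑ j ∈ Finset.range (n + 1),
            ((n + 1).choose (j + 1) : ℝ≥0∞) * M ^ (n - j) * (f (x - y) * f y * hfun f j y) := by
            refine lintegral_mono fun y => ?_
            refine (mul_le_mul_right (ih y) _).trans (le_of_eq ?_)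
            rw [Finset.sum_mul, Finset.mul_sum]
            refine Finset.sum_congr rfl fun j _ => ?_
            ring
        _ = _ := by
            rw [lintegral_finsetSum _ (fun j _ => by fun_prop)]
            refine Finset.sum_congr rfl fun j _ => ?_
            rw [lintegral_const_mul _ (by fun_prop), hfun_mul f x (hpos x).ne' ht]
    have p2 : iterConv f n z * N ≤ ∑ j ∈ Finset.range (n + 1),
          ((n + 1).choose (j + 1) : ℝ≥0∞) * M ^ (n + 1 - j) * (hfun f j x * f x) := by
      refine (mul_le_mul_left (ih z) _).trans ?_
      rw [Finset.sum_mul, Finset.sum_mul]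
      refine Finset.sum_le_sum fun j hj => ?_
      have : n + 1 - j = (n - j) + 1 := by
        have := Finset.mem_range.1 hj
        omega
      rw [this, pow_succ]
      calc _ = ((n + 1).choose (j + 1) : ℝ≥0∞) * M ^ (n - j) * N * (hfun f j z * f z) := by ring
        _ ≤ ((n + 1).choose (j + 1) : ℝ≥0∞) * M ^ (n - j) * N * (C * (hfun f j x * f x)) := by
            exact mul_le_mul_right (hzj j) _
        _ = _ := by rw [← hMM]; ring
    have p3 : f z * N ^ (n + 1) ≤ M ^ (n + 1) * f x := by
      calc _ ≤ C * f x * N ^ (n + 1) := by gcongr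
        _ ≤ C ^ (n + 1) * f x * N ^ (n + 1) := by
            gcongr; exact le_self_pow₀ hC1 (by omega)
        _ = _ := by rw [← hMM]; ring
    have split : iterConv f (n + 1) x ≤ (∫⁻ y in Dset x, f (x - y) * iterConv f n y) +
        iterConv f n z * N + f z * N ^ (n + 1) := by
      rw [← iterConv_int f hmeas n, ← lintegral_const_mul _ hcm, ← hfx,
        ← lintegral_const_mul _ (by fun_prop), ← lintegral_indicator (Dset_meas x),
        ← lintegral_add_right _ (by fun_prop), ← lintegral_add_right _ (by fun_prop)]
      simp only [iterConv]
      refine lintegral_mono fun y => ?_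
      rcases hz2 y with h | h | h
      · simp only [indicator_of_mem h]
        exact le_self_add.trans le_self_add
      · refine le_trans ?_ le_self_add
        refine le_trans ?_ le_add_self
        rw [mul_comm]
        gcongr
        exact iterConv_anti f hmeas hfa n _ _ h
      · refine le_trans ?_ le_add_self
        gcongr
        exact hfa _ _ h
    refine split.trans ((add_le_add (add_le_add p1 p2) p3).trans (le_of_eq ?_))
    rw [Finset.sum_mul, Finset.sum_range_succ' _ (n + 1)]
    have e : ∀ j ∈ Finset.range (n + 1),
      ((n + 1 + 1).choose (j + 1 + 1) : ℝ≥0∞) * M ^ (n + 1 - (j + 1)) * hfun f (j + 1) x * f x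
      = ((n + 1).choose (j + 1) : ℝ≥0∞) * M ^ (n - j) * (hfun f (j + 1) x * f x)
       + ((n + 1).choose (j + 1 + 1) : ℝ≥0∞) * M ^ (n + 1 - (j + 1)) * (hfun f (j + 1) x * f x) := by
      intro j _
      rw [Nat.choose_succ_succ (n + 1) (j + 1), Nat.add_sub_add_right]
      push_cast
      ring
    rw [Finset.sum_congr rfl e, Finset.sum_add_distrib, add_assoc, add_assoc]
    congr 1
    have e2 : ∑ j ∈ Finset.range (n + 1),
        ((n + 1).choose (j + 1) : ℝ≥0∞) * M ^ (n + 1 - j) * (hfun f j x * f x) =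
        ∑ j ∈ Finset.range (n + 2),
        ((n + 1).choose (j + 1) : ℝ≥0∞) * M ^ (n + 1 - j) * (hfun f j x * f x) := by
      rw [Finset.sum_range_succ _ (n + 1), Nat.choose_eq_zero_of_lt (by omega : n + 1 < n + 1 + 1)]
      simp
    rw [e2, Finset.sum_range_succ' _ (n + 1), add_assoc]
    congr 1
    simp [hfun]
    ring
end
end

section
/- Let f satisfy Assumption (A) and let M₂ := (C₁ ∨ C₂)·‖f‖₁. Then for every λ > 0: (i) for |x| < 1, λ e^{−λ‖f‖₁} f(x) ≤ p_λ(x) ≤ e^{(M₂−‖f‖₁)λ} λ f(x); and (ii) for |x| ≥ 1, 1 ≤ p_λ(x) / ( e^{−λ‖f‖₁} f(x) ∑_{n=1}^∞ λⁿ h_n(x)/n! ) ≤ e^{M₂λ}. Moreover (ii) also holds with the functions h_n replaced by the functions g_n, with the same constants. -/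
open MeasureTheory Filter Topology ENNReal Set

noncomputable section

/-- The density `p_λ(x) = e^{-λ‖f‖₁} ∑_{n=1}^∞ λⁿ f^{n⋆}(x)/n!` of the absolutely
continuous part of the compound Poisson measure built from `f`. -/
def pdens {d : ℕ} (f : EuclideanSpace ℝ (Fin d) → ℝ≥0∞) (lam : ℝ)
    (x : EuclideanSpace ℝ (Fin d)) : ℝ≥0∞ :=
  ENNReal.ofReal (Real.exp (-(lam * (∫⁻ y, f y).toReal))) *
    ∑' n : ℕ, ENNReal.ofReal lam ^ (n + 1) * iterConv f n x / (Nat.factorial (n + 1) : ℝ≥0∞)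

section aux

variable {d : ℕ} {f : EuclideanSpace ℝ (Fin d) → ℝ≥0∞}

lemma measurable_iterConv (hf : Measurable f) (n : ℕ) : Measurable (iterConv f n) := by
  induction n with
  | zero => exact hf
  | succ n ih =>
    unfold iterConv
    exact Measurable.lintegral_prod_right'
      (f := fun p : EuclideanSpace ℝ (Fin d) × EuclideanSpace ℝ (Fin d) =>
        f (p.1 - p.2) * iterConv f n p.2) (by fun_prop)

lemma lintegral_iterConv (hf : Measurable f) (n : ℕ) :
    ∫⁻ x, iterConv f n x = (∫⁻ x, f x) ^ (n + 1) := by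
  induction n with
  | zero => simp [iterConv]
  | succ n ih =>
    have hm := measurable_iterConv hf n
    unfold iterConv
    rw [lintegral_lintegral_swap
      (by unfold Function.uncurry; exact Measurable.aemeasurable (by fun_prop))]
    have : ∀ y, ∫⁻ x, f (x - y) * iterConv f n y = (∫⁻ x, f x) * iterConv f n y := by
      intro y
      rw [lintegral_mul_const _ (by fun_prop), lintegral_sub_right_eq_self]
    simp_rw [this]
    rw [lintegral_const_mul _ hm, ih, pow_succ' _ (n+1)]

lemma iterConv_isom {q : ℝ → ℝ≥0∞} (hfq : ∀ x, f x = q ‖x‖)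
    (T : EuclideanSpace ℝ (Fin d) ≃ₗᵢ[ℝ] EuclideanSpace ℝ (Fin d)) (n : ℕ) :
    ∀ x, iterConv f n (T x) = iterConv f n x := by
  induction n with
  | zero => intro x; simp [iterConv, hfq]
  | succ n ih =>
    intro x
    unfold iterConv
    rw [← T.measurePreserving.lintegral_comp_emb T.toHomeomorph.measurableEmbedding]
    refine lintegral_congr fun y => ?_
    rw [ih, ← map_sub, hfq, hfq (x - y), T.norm_map]

lemma iterConv_radial {q : ℝ → ℝ≥0∞} (hfq : ∀ x, f x = q ‖x‖) (n : ℕ)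
    {x y : EuclideanSpace ℝ (Fin d)} (h : ‖x‖ = ‖y‖) : iterConv f n x = iterConv f n y := by
  rw [← Submodule.reflection_sub h, iterConv_isom hfq]

lemma measurableSet_Dset (x : EuclideanSpace ℝ (Fin d)) : MeasurableSet (Dset x) := by
  unfold Dset
  simp only [ofPred_and]
  refine (measurableSet_lt ?_ ?_).inter (measurableSet_lt ?_ ?_) <;> fun_prop

lemma measurable_hfun (hf : Measurable f) (n : ℕ) : Measurable (hfun f n) := by
  induction n with
  | zero => exact measurable_const
  | succ n ih =>
    unfold hfun
    refine Measurable.div ?_ hf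
    have hD : ∀ x : EuclideanSpace ℝ (Fin d), MeasurableSet (Dset x) := by
      intro x
      exact measurableSet_Dset x
    simp_rw [← lintegral_indicator (hD _)]
    have hS : MeasurableSet {p : EuclideanSpace ℝ (Fin d) × EuclideanSpace ℝ (Fin d) |
        ‖p.2‖ < ‖p.1‖ - 1 ∧ ‖p.1 - p.2‖ < ‖p.1‖ - 1} := by
      simp only [ofPred_and]
      refine (measurableSet_lt ?_ ?_).inter (measurableSet_lt ?_ ?_) <;> fun_prop
    exact Measurable.lintegral_prod_right' (Measurable.indicator (f :=
      fun p : EuclideanSpace ℝ (Fin d) × EuclideanSpace ℝ (Fin d) =>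
        f (p.1 - p.2) * f p.2 * hfun f n p.2) (by fun_prop) hS)

lemma hfun_le_gfun (n : ℕ) : ∀ x, hfun f n x ≤ gfun f n x := by
  induction n with
  | zero => intro x; exact le_rfl
  | succ n ih =>
    intro x
    unfold hfun gfun
    gcongr with y
    · intro z hz
      exact ⟨by linarith [hz.1], by linarith [hz.2]⟩
    · exact ih y

lemma mul_gfun_le (n : ℕ) : ∀ x, f x * gfun f n x ≤ iterConv f n x := by
  induction n with
  | zero => intro x; simp [gfun, iterConv]
  | succ n ih =>
    intro x
    unfold gfun iterConv
    refine ENNReal.mul_div_le.trans ((setLIntegral_le_lintegral _ _).trans ?_)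
    refine lintegral_mono fun y => ?_
    dsimp only
    rw [mul_assoc]
    gcongr
    exact ih y

/-- crude bound near the origin -/
lemma iterConv_le_small (hf : Measurable f) {q : ℝ → ℝ≥0∞} (hq : Antitone q)
    (hfq : ∀ x, f x = q ‖x‖) {C : ℝ≥0∞} (hC1 : 1 ≤ C)
    (hq2 : ∀ r : ℝ, 0 ≤ r → r ≤ 2 → q (r / 2) ≤ C * q r) (n : ℕ) :
    ∀ (r : ℝ) (x : EuclideanSpace ℝ (Fin d)), 0 ≤ r → r ≤ 2 → r ≤ ‖x‖ →
      iterConv f n x ≤ (n + 1 : ℕ) * (C * ∫⁻ y, f y) ^ n * q r := by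
  induction n with
  | zero => intro r x h0 h2 hx; simp only [iterConv, hfq]; simpa using hq hx
  | succ n ih =>
    intro r x h0 h2 hx
    have hm := measurable_iterConv hf n
    set ℓ := ∫⁻ y, f y with hℓ
    have key : ∀ y, f (x - y) * iterConv f n y ≤
        (C * q r) * iterConv f n y + f (x - y) * ((n + 1 : ℕ) * (C * ℓ) ^ n * (C * q r)) := by
      intro y
      by_cases h : r / 2 ≤ ‖x - y‖
      · refine le_add_right ?_
        gcongr
        rw [hfq]
        exact (hq h).trans (hq2 r h0 h2)
      · refine le_add_left ?_
        have hy : r / 2 ≤ ‖y‖ := by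
          have := norm_sub_norm_le x y
          push Not at h
          linarith
        gcongr
        refine (ih (r / 2) y (by linarith) (by linarith) hy).trans ?_
        gcongr
        exact hq2 r h0 h2
    have h1 : iterConv f (n + 1) x = ∫⁻ y, f (x - y) * iterConv f n y := rfl
    rw [h1]
    refine (lintegral_mono key).trans ?_
    rw [lintegral_add_left (by fun_prop), lintegral_const_mul _ hm, lintegral_iterConv hf,
      lintegral_mul_const _ (by fun_prop), lintegral_sub_left_eq_self (fun y => f y), ← hℓ]
    calc C * q r * ℓ ^ (n + 1) + ℓ * (((n + 1 : ℕ) : ℝ≥0∞) * (C * ℓ) ^ n * (C * q r))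
        ≤ C ^ (n + 1) * q r * ℓ ^ (n + 1)
          + ℓ * (((n + 1 : ℕ) : ℝ≥0∞) * (C * ℓ) ^ n * (C * q r)) := by
          gcongr
          exact le_self_pow hC1 (by omega)
      _ = _ := by push_cast; ring

lemma q_iter {q : ℝ → ℝ≥0∞} {C : ℝ≥0∞} (hC1 : 1 ≤ C)
    (hq1 : ∀ a b : ℝ, 1 ≤ a → a ≤ b → b ≤ a + 1 → q a ≤ C * q b) (j : ℕ) :
    ∀ a b : ℝ, 1 ≤ a → a ≤ b → b ≤ a + j → q a ≤ C ^ j * q b := by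
  induction j with
  | zero => intro a b h1 h2 h3; simp at h3; simp [le_antisymm h2 h3]
  | succ j ih =>
    intro a b h1 h2 h3
    push_cast at h3
    rcases le_total b (a + 1) with h | h
    · refine (hq1 a b h1 h2 h).trans ?_
      gcongr
      exact le_self_pow hC1 (by omega)
    · refine (hq1 a (a + 1) h1 (by linarith) le_rfl).trans ?_
      rw [pow_succ', mul_assoc]
      gcongr
      exact ih _ _ (by linarith) h (by linarith)

/-- the comparison sum -/
def Ssum (f : EuclideanSpace ℝ (Fin d) → ℝ≥0∞) (M : ℝ≥0∞) (n : ℕ)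
    (x : EuclideanSpace ℝ (Fin d)) : ℝ≥0∞ :=
  ∑ k ∈ Finset.range (n + 1), ((n + 1).choose (k + 1) : ℝ≥0∞) * M ^ (n - k) * (f x * hfun f k x)

lemma Ssum_succ (M : ℝ≥0∞) (n : ℕ) (x : EuclideanSpace ℝ (Fin d)) :
    Ssum f M (n + 1) x = M ^ (n + 1) * f x + M * Ssum f M n x +
      ∑ k ∈ Finset.range (n + 1),
        ((n + 1).choose (k + 1) : ℝ≥0∞) * M ^ (n - k) * (f x * hfun f (k + 1) x) := by
  unfold Ssum
  simp_rw [Nat.choose_succ_succ' (n + 1), Nat.cast_add, add_mul, Finset.sum_add_distrib]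
  rw [Finset.sum_range_succ'
      (fun k => ((n + 1).choose k : ℝ≥0∞) * M ^ (n + 1 - k) * (f x * hfun f k x)) (n + 1),
    Finset.sum_range_succ
      (fun k => ((n + 1).choose (k + 1) : ℝ≥0∞) * M ^ (n + 1 - k) * (f x * hfun f k x)) (n + 1),
    Finset.mul_sum]
  have e : ∀ k ∈ Finset.range (n + 1),
      ((n + 1).choose (k + 1) : ℝ≥0∞) * M ^ (n + 1 - k) * (f x * hfun f k x)
      = M * (((n + 1).choose (k + 1) : ℝ≥0∞) * M ^ (n - k) * (f x * hfun f k x)) := by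
    intro k hk
    rw [Nat.succ_sub (by simpa [Nat.lt_succ_iff] using hk), pow_succ]
    ring
  rw [Finset.sum_congr rfl e]
  simp [hfun]
  ring

lemma small_le_Ssum (M : ℝ≥0∞) (n : ℕ) (x : EuclideanSpace ℝ (Fin d)) :
    (n + 1 : ℕ) * M ^ n * f x ≤ Ssum f M n x := by
  unfold Ssum
  rw [Finset.sum_range_succ']
  refine le_add_left ?_
  simp [hfun]

lemma f_ne_top (hf : Measurable f) (hint : ∫⁻ x, f x ≠ ⊤) {q : ℝ → ℝ≥0∞}
    (hq : Antitone q) (hfq : ∀ x, f x = q ‖x‖) {x : EuclideanSpace ℝ (Fin d)} (hx : 1 ≤ ‖x‖) :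
    f x ≠ ⊤ := by
  intro h
  have hae := ae_lt_top hf hint
  rw [ae_iff] at hae
  have hpos := Metric.measure_ball_pos (volume : Measure (EuclideanSpace ℝ (Fin d)))
    (0 : EuclideanSpace ℝ (Fin d)) one_pos
  have : volume (Metric.ball (0 : EuclideanSpace ℝ (Fin d)) 1) = 0 := by
    refine measure_mono_null ?_ hae
    intro y hy
    have hy' : ‖y‖ < 1 := by simpa using hy
    have : f x ≤ f y := by rw [hfq, hfq]; exact hq (by linarith)
    rw [h] at this
    simpa using this
  exact hpos.ne' this

lemma mul_hfun_succ {x : EuclideanSpace ℝ (Fin d)} (h0 : f x ≠ 0) (ht : f x ≠ ⊤) (k : ℕ) :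
    f x * hfun f (k + 1) x = ∫⁻ y in Dset x, f (x - y) * f y * hfun f k y := by
  have : hfun f (k + 1) x = (∫⁻ y in Dset x, f (x - y) * f y * hfun f k y) / f x := rfl
  rw [this, ENNReal.mul_div_cancel h0 ht]

lemma measurable_Ssum (hf : Measurable f) (M : ℝ≥0∞) (n : ℕ) : Measurable (Ssum f M n) := by
  have := measurable_hfun hf
  unfold Ssum
  fun_prop

lemma setLIntegral_Ssum (hf : Measurable f) {x : EuclideanSpace ℝ (Fin d)} (h0 : f x ≠ 0)
    (ht : f x ≠ ⊤) (M : ℝ≥0∞) (n : ℕ) :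
    ∫⁻ y in Dset x, f (x - y) * Ssum f M n y = ∑ k ∈ Finset.range (n + 1),
        ((n + 1).choose (k + 1) : ℝ≥0∞) * M ^ (n - k) * (f x * hfun f (k + 1) x) := by
  have hm := measurable_hfun hf
  simp_rw [mul_hfun_succ h0 ht, Ssum, Finset.mul_sum]
  rw [lintegral_finsetSum _ (fun k _ => by fun_prop)]
  refine Finset.sum_congr rfl fun k _ => ?_
  rw [← lintegral_const_mul _ (by fun_prop)]
  refine lintegral_congr fun y => ?_
  ring

lemma exists_norm_eq_of_dim (hd : 0 < d) {c : ℝ} (hc : 0 ≤ c) :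
    ∃ x : EuclideanSpace ℝ (Fin d), ‖x‖ = c :=
  ⟨EuclideanSpace.single ⟨0, hd⟩ c, by simp [abs_of_nonneg hc]⟩

/-- geometric comparison on a ray -/
lemma ray_le {x z : EuclideanSpace ℝ (Fin d)} {t : ℝ} (ht : 1 ≤ t) (hz : ‖z‖ ≤ ‖x‖) :
    ‖x - z‖ ≤ ‖t • x - z‖ := by
  have h1 : ‖t • x - z‖ ^ 2 = t ^ 2 * ‖x‖ ^ 2 - 2 * (t * inner ℝ x z) + ‖z‖ ^ 2 := by
    rw [norm_sub_sq_real, norm_smul, inner_smul_left, mul_pow, Real.norm_eq_abs, sq_abs]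
    simp
  have h2 := norm_sub_sq_real x z
  have h3 : inner ℝ x z ≤ ‖x‖ ^ 2 := by
    refine (real_inner_le_norm x z).trans ?_
    nlinarith [norm_nonneg x]
  refine le_of_sq_le_sq ?_ (norm_nonneg _)
  rw [h1, h2]
  nlinarith [mul_le_mul_of_nonneg_left h3 (sub_nonneg.2 ht),
    mul_nonneg (mul_nonneg (sub_nonneg.2 ht) (sub_nonneg.2 ht)) (sq_nonneg ‖x‖)]

lemma main_bound (hf : Measurable f) (hpos : ∀ x, 0 < f x) (hint : ∫⁻ x, f x ≠ ⊤)
    {q : ℝ → ℝ≥0∞} (hq : Antitone q)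
    (hfq : ∀ x, f x = q ‖x‖) {C : ℝ≥0∞} (hC1 : 1 ≤ C)
    (hq1 : ∀ a b : ℝ, 1 ≤ a → a ≤ b → b ≤ a + 1 → q a ≤ C * q b)
    (hq2 : ∀ r : ℝ, 0 ≤ r → r ≤ 2 → q (r / 2) ≤ C * q r) (n : ℕ) :
    ∀ (j : ℕ) (x y : EuclideanSpace ℝ (Fin d)), 1 + j ≤ ‖x‖ → ‖x‖ - j ≤ ‖y‖ →
      iterConv f n y ≤ C ^ j * Ssum f (C * ∫⁻ y, f y) n x := by
  induction n with
  | zero =>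
    intro j x y hx hy
    have hj : (0 : ℝ) ≤ j := j.cast_nonneg
    have h0 : Ssum f (C * ∫⁻ y, f y) 0 x = q ‖x‖ := by simp [Ssum, hfun, hfq]
    have h1 : iterConv f 0 y = q ‖y‖ := hfq y
    have h2 : q (‖x‖ - j) ≤ C ^ j * q ‖x‖ :=
      q_iter hC1 hq1 j _ _ (by linarith) (by linarith) (by linarith)
    rw [h0, h1]
    exact (hq hy).trans h2
  | succ n ih =>
    intro j x y hx hy
    have hj : (0 : ℝ) ≤ j := j.cast_nonneg
    have hm := measurable_iterConv hf n
    set ℓ := ∫⁻ y, f y with hℓ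
    by_cases hsm : ‖x‖ - j < 2
    · refine (iterConv_le_small hf hq hfq hC1 hq2 (n + 1) (‖x‖ - j) y (by linarith) hsm.le hy).trans
        ?_
      calc ((n + 1 + 1 : ℕ) : ℝ≥0∞) * (C * ℓ) ^ (n + 1) * q (‖x‖ - j)
          ≤ ((n + 1 + 1 : ℕ) : ℝ≥0∞) * (C * ℓ) ^ (n + 1) * (C ^ j * q ‖x‖) := by
            gcongr
            exact q_iter hC1 hq1 j _ _ (by linarith) (by linarith) (by linarith)
        _ = C ^ j * (((n + 1 + 1 : ℕ) : ℝ≥0∞) * (C * ℓ) ^ (n + 1) * f x) := by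
            rw [hfq]; ring
        _ ≤ _ := by gcongr; exact small_le_Ssum _ _ _
    push Not at hsm
    have hP : ∀ z, iterConv f n z ≤ Ssum f (C * ℓ) n z := by
      intro z
      rcases le_total 1 ‖z‖ with h | h
      · simpa using ih 0 z z (by simpa using h) (by simp)
      · refine (iterConv_le_small hf hq hfq hC1 hq2 n ‖z‖ z (norm_nonneg _) (by linarith)
          le_rfl).trans ?_
        rw [← hfq]
        exact small_le_Ssum _ _ _
    have hxpos : 0 < ‖x‖ := by linarith
    -- move `y` to the ray through `x`
    obtain ⟨t, ht0, hyt⟩ : ∃ t : ℝ, 0 ≤ t ∧ ‖y‖ = ‖t • x‖ := by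
      refine ⟨‖y‖ / ‖x‖, by positivity, ?_⟩
      rw [norm_smul, Real.norm_eq_abs, abs_of_nonneg (by positivity)]
      field_simp
    rw [iterConv_radial hfq (n + 1) hyt]
    rw [hyt] at hy
    have hshift : ∀ z, ‖z‖ < ‖x‖ - j - 1 → ‖x - z‖ ≤ ‖t • x - z‖ + j := by
      intro z hz
      rcases le_total 1 t with h | h
      · linarith [ray_le (x := x) (z := z) h (by linarith)]
      · have h1 : ‖x - z‖ ≤ ‖t • x - z‖ + ‖(1 - t) • x‖ := by
          have : x - z = (t • x - z) + (1 - t) • x := by module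
          rw [this]
          exact norm_add_le _ _
        have h2 : ‖(1 - t) • x‖ = ‖x‖ - ‖t • x‖ := by
          rw [norm_smul, norm_smul, Real.norm_eq_abs, Real.norm_eq_abs, abs_of_nonneg ht0,
            abs_of_nonneg (sub_nonneg.2 h)]
          ring
        linarith
    set w := t • x with hw
    have key : ∀ z, f (w - z) * iterConv f n z ≤
        (C ^ (j + 1) * f x) * iterConv f n z
        + (f (w - z) * (C ^ (j + 1) * Ssum f (C * ℓ) n x)
        + (Dset x).indicator (fun z => C ^ j * (f (x - z) * Ssum f (C * ℓ) n z)) z) := by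
      intro z
      by_cases hA : ‖x‖ - j - 1 ≤ ‖w - z‖
      · refine le_add_right ?_
        gcongr
        rw [hfq, hfq]
        exact (hq hA).trans (q_iter hC1 hq1 (j + 1) _ _ (by linarith) (by linarith)
          (by push_cast; linarith))
      by_cases hB : ‖x‖ - j - 1 ≤ ‖z‖
      · refine le_add_left (le_add_right ?_)
        gcongr
        exact ih (j + 1) x z (by push_cast; linarith) (by push_cast; linarith)
      push Not at hA hB
      refine le_add_left (le_add_left ?_)
      have h1 := hshift z hB
      have hmem : z ∈ Dset x := ⟨by linarith, by linarith⟩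
      rw [indicator_of_mem hmem, ← mul_assoc]
      gcongr
      · rw [hfq, hfq]
        have h3 := norm_sub_norm_le w z
        rcases le_total ‖x - z‖ ‖w - z‖ with h | h
        · refine (hq h).trans ?_
          exact le_mul_of_one_le_left (by simp) (one_le_pow₀ hC1)
        · exact q_iter hC1 hq1 j _ _ (by linarith) h h1
      · exact hP z
    have h1 : iterConv f (n + 1) w = ∫⁻ y, f (w - y) * iterConv f n y := rfl
    rw [h1]
    refine (lintegral_mono key).trans ?_
    have hS := measurable_Ssum hf (C * ℓ) n
    rw [lintegral_add_left (by fun_prop), lintegral_add_left (by fun_prop),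
      lintegral_const_mul _ hm, lintegral_iterConv hf,
      lintegral_mul_const _ (by fun_prop), lintegral_sub_left_eq_self (fun y => f y), ← hℓ,
      lintegral_indicator (measurableSet_Dset x), lintegral_const_mul _ (by fun_prop),
      setLIntegral_Ssum hf (hpos x).ne' (f_ne_top hf hint hq hfq (by linarith)), Ssum_succ]
    rw [mul_add, mul_add, ← add_assoc]
    refine add_le_add (add_le_add ?_ ?_) le_rfl
    · calc C ^ (j + 1) * f x * ℓ ^ (n + 1) ≤ C ^ (j + (n + 1)) * f x * ℓ ^ (n + 1) := by
            gcongr ?_ * _ * _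
            exact pow_le_pow_right₀ hC1 (by omega)
        _ = C ^ j * ((C * ℓ) ^ (n + 1) * f x) := by ring
    · apply le_of_eq; ring

lemma iterConv_le_Ssum (hf : Measurable f) (hpos : ∀ x, 0 < f x) (hint : ∫⁻ x, f x ≠ ⊤)
    {q : ℝ → ℝ≥0∞} (hq : Antitone q)
    (hfq : ∀ x, f x = q ‖x‖) {C : ℝ≥0∞} (hC1 : 1 ≤ C)
    (hq1 : ∀ a b : ℝ, 1 ≤ a → a ≤ b → b ≤ a + 1 → q a ≤ C * q b)
    (hq2 : ∀ r : ℝ, 0 ≤ r → r ≤ 2 → q (r / 2) ≤ C * q r) (n : ℕ)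
    (x : EuclideanSpace ℝ (Fin d)) (hx : 1 ≤ ‖x‖) :
      iterConv f n x ≤ Ssum f (C * ∫⁻ y, f y) n x := by
  simpa using main_bound hf hpos hint hq hfq hC1 hq1 hq2 n 0 x x (by simpa using hx) (by simp)

lemma ofReal_exp_eq {a : ℝ} (ha : 0 ≤ a) :
    ENNReal.ofReal (Real.exp a) = ∑' n : ℕ, ENNReal.ofReal a ^ n / (n.factorial : ℝ≥0∞) := by
  have h := NormedSpace.expSeries_div_hasSum_exp a
  rw [← Real.exp_eq_exp_ℝ] at h
  rw [← h.tsum_eq, ENNReal.ofReal_tsum_of_nonneg (fun n => by positivity) h.summable]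
  refine tsum_congr fun n => ?_
  rw [ENNReal.ofReal_div_of_pos (by positivity), ENNReal.ofReal_pow ha, ENNReal.ofReal_natCast]

lemma tsum_cauchy (a b : ℕ → ℝ≥0∞) :
    ∑' n : ℕ, ∑ k ∈ Finset.range (n + 1), a (n - k) * b k = (∑' n, a n) * ∑' k, b k := by
  have h : ∀ n : ℕ, ∑ k ∈ Finset.range (n + 1), a (n - k) * b k
      = ∑' k, if k ≤ n then a (n - k) * b k else 0 := by
    intro n
    rw [tsum_eq_sum (s := Finset.range (n + 1))]
    · refine Finset.sum_congr rfl fun k hk => ?_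
      rw [if_pos (by simpa [Nat.lt_succ_iff] using hk)]
    · intro k hk
      rw [if_neg (by simpa [Nat.lt_succ_iff] using hk)]
  simp_rw [h]
  rw [ENNReal.tsum_comm, ← ENNReal.tsum_mul_left]
  refine tsum_congr fun k => ?_
  rw [← ENNReal.tsum_mul_right]
  rw [← (ENNReal.summable).sum_add_tsum_nat_add' (k := k)]
  rw [Finset.sum_eq_zero (fun i hi => if_neg (by simpa using hi)), zero_add]
  simp

lemma tsum_Ssum (M l : ℝ≥0∞) (x : EuclideanSpace ℝ (Fin d)) :
    ∑' n : ℕ, l ^ (n + 1) * Ssum f M n x / (Nat.factorial (n + 1) : ℝ≥0∞)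
      = (∑' n : ℕ, (M * l) ^ n / (n.factorial : ℝ≥0∞)) *
        (f x * ∑' n : ℕ, l ^ (n + 1) * hfun f n x / (Nat.factorial (n + 1) : ℝ≥0∞)) := by
  rw [← ENNReal.tsum_mul_left, ← tsum_cauchy]
  refine tsum_congr fun n => ?_
  unfold Ssum
  rw [Finset.mul_sum, div_eq_mul_inv, Finset.sum_mul]
  refine Finset.sum_congr rfl fun k hk => ?_
  have hk' : k ≤ n := by simpa [Nat.lt_succ_iff] using hk
  obtain ⟨m, rfl⟩ := Nat.exists_eq_add_of_le hk'
  have hc : ((k + m + 1).choose (k + 1) : ℝ≥0∞) * ((k + m + 1).factorial : ℝ≥0∞)⁻¹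
      = (m.factorial : ℝ≥0∞)⁻¹ * ((k + 1).factorial : ℝ≥0∞)⁻¹ := by
    have := Nat.choose_mul_factorial_mul_factorial (n := k + m + 1) (k := k + 1) (by omega)
    rw [show k + m + 1 - (k + 1) = m by omega] at this
    rw [← this]
    have hne : ((k + m + 1).choose (k + 1) : ℝ≥0∞) ≠ 0 := by
      exact_mod_cast (Nat.choose_pos (by omega)).ne'
    push_cast
    rw [mul_assoc, ENNReal.mul_inv (Or.inl hne) (Or.inl (ENNReal.natCast_ne_top _)), ← mul_assoc,
      ENNReal.mul_inv_cancel hne (ENNReal.natCast_ne_top _), one_mul,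
      ENNReal.mul_inv (Or.inr (ENNReal.natCast_ne_top _)) (Or.inl (ENNReal.natCast_ne_top _)),
      mul_comm]
  rw [show k + m - k = m by omega, div_eq_mul_inv, div_eq_mul_inv]
  calc _ = ((k + m + 1).choose (k + 1) : ℝ≥0∞) * ((k + m + 1).factorial : ℝ≥0∞)⁻¹ *
      (l ^ (k + m + 1) * M ^ m * (f x * hfun f k x)) := by ring
    _ = _ := by rw [hc]; ring

end aux

/-- Under Assumption (A), with `M₂ = (C₁ ∨ C₂)·‖f‖₁`, for every `λ > 0`:
(i) for `|x| < 1`, `λ e^{-λ‖f‖₁} f(x) ≤ p_λ(x) ≤ e^{(M₂-‖f‖₁)λ} λ f(x)`;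
(ii) for `|x| ≥ 1`,
`e^{-λ‖f‖₁} f(x) ∑_{n≥1} λⁿ h_n(x)/n! ≤ p_λ(x) ≤ e^{M₂λ} e^{-λ‖f‖₁} f(x) ∑_{n≥1} λⁿ h_n(x)/n!`,
and the same with the `g_n` in place of the `h_n`. -/
theorem stmt2 (d : ℕ) (hd : 0 < d) (f : EuclideanSpace ℝ (Fin d) → ℝ≥0∞)
    (hmeas : Measurable f) (hpos : ∀ x, 0 < f x) (hint : ∫⁻ x, f x ≠ ⊤)
    (q : ℝ → ℝ≥0∞) (hq : Antitone q) (hfq : ∀ x, f x = q ‖x‖)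
    (C₁ C₂ : ℝ) (hC₁ : 1 ≤ C₁) (hC₂ : 1 ≤ C₂)
    (hC1f : ∀ x y : EuclideanSpace ℝ (Fin d), 1 ≤ ‖x‖ → ‖x‖ ≤ ‖y‖ → ‖y‖ ≤ ‖x‖ + 1 →
      f x ≤ ENNReal.ofReal C₁ * f y)
    (hC2f : ∀ x : EuclideanSpace ℝ (Fin d), ‖x‖ ≤ 1 → f x ≤ ENNReal.ofReal C₂ * f ((2 : ℝ) • x))
    (L : ℝ) (hL : L = (∫⁻ y, f y).toReal)
    (M₂ : ℝ) (hM₂ : M₂ = max C₁ C₂ * L) :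
    ∀ lam : ℝ, 0 < lam →
      (∀ x : EuclideanSpace ℝ (Fin d), ‖x‖ < 1 →
        ENNReal.ofReal (lam * Real.exp (-(lam * L))) * f x ≤ pdens f lam x ∧
        pdens f lam x ≤ ENNReal.ofReal (Real.exp ((M₂ - L) * lam) * lam) * f x) ∧
      (∀ x : EuclideanSpace ℝ (Fin d), 1 ≤ ‖x‖ →
        (ENNReal.ofReal (Real.exp (-(lam * L))) * f x *
            ∑' n : ℕ, ENNReal.ofReal lam ^ (n + 1) * hfun f n x / (Nat.factorial (n + 1) : ℝ≥0∞)
              ≤ pdens f lam x ∧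
          pdens f lam x ≤ ENNReal.ofReal (Real.exp (M₂ * lam)) *
            (ENNReal.ofReal (Real.exp (-(lam * L))) * f x *
              ∑' n : ℕ, ENNReal.ofReal lam ^ (n + 1) * hfun f n x /
                (Nat.factorial (n + 1) : ℝ≥0∞))) ∧
        (ENNReal.ofReal (Real.exp (-(lam * L))) * f x *
            ∑' n : ℕ, ENNReal.ofReal lam ^ (n + 1) * gfun f n x / (Nat.factorial (n + 1) : ℝ≥0∞)
              ≤ pdens f lam x ∧
          pdens f lam x ≤ ENNReal.ofReal (Real.exp (M₂ * lam)) *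
            (ENNReal.ofReal (Real.exp (-(lam * L))) * f x *
              ∑' n : ℕ, ENNReal.ofReal lam ^ (n + 1) * gfun f n x /
                (Nat.factorial (n + 1) : ℝ≥0∞)))) := by

  intro lam hlam
  set C : ℝ≥0∞ := ENNReal.ofReal (max C₁ C₂) with hC
  have hC1 : 1 ≤ C := by
    rw [hC, ENNReal.one_le_ofReal]
    exact hC₁.trans (le_max_left _ _)
  have hq1 : ∀ a b : ℝ, 1 ≤ a → a ≤ b → b ≤ a + 1 → q a ≤ C * q b := by
    intro a b h1 h2 h3
    obtain ⟨x, hx⟩ := exists_norm_eq_of_dim hd (c := a) (by linarith)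
    obtain ⟨y, hy⟩ := exists_norm_eq_of_dim hd (c := b) (by linarith)
    have := hC1f x y (by linarith) (by linarith) (by linarith)
    rw [hfq, hfq, hx, hy] at this
    refine this.trans ?_
    exact mul_le_mul_left (ENNReal.ofReal_le_ofReal (le_max_left _ _)) _
  have hq2 : ∀ r : ℝ, 0 ≤ r → r ≤ 2 → q (r / 2) ≤ C * q r := by
    intro r h1 h2
    obtain ⟨x, hx⟩ := exists_norm_eq_of_dim hd (c := r / 2) (by linarith)
    have := hC2f x (by linarith)
    rw [hfq, hfq, norm_smul, hx] at this
    rw [show ‖(2 : ℝ)‖ * (r / 2) = r by simp; ring] at this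
    refine this.trans ?_
    exact mul_le_mul_left (ENNReal.ofReal_le_ofReal (le_max_right _ _)) _
  have hL0 : 0 ≤ L := hL ▸ ENNReal.toReal_nonneg
  have hm0 : 0 ≤ max C₁ C₂ := by linarith [le_max_left C₁ C₂]
  have hM0 : 0 ≤ M₂ := hM₂ ▸ mul_nonneg hm0 hL0
  have hLe : ENNReal.ofReal L = ∫⁻ y, f y := by rw [hL, ENNReal.ofReal_toReal hint]
  have hMe : C * ∫⁻ y, f y = ENNReal.ofReal M₂ := by
    rw [hM₂, ENNReal.ofReal_mul hm0, hLe]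
  have hexp : ENNReal.ofReal (Real.exp (M₂ * lam)) =
      ∑' n : ℕ, ((C * ∫⁻ y, f y) * ENNReal.ofReal lam) ^ n / (n.factorial : ℝ≥0∞) := by
    rw [ofReal_exp_eq (by positivity), hMe, ENNReal.ofReal_mul hM0]
  have hup : ∀ x : EuclideanSpace ℝ (Fin d), 1 ≤ ‖x‖ →
      pdens f lam x ≤ ENNReal.ofReal (Real.exp (M₂ * lam)) *
            (ENNReal.ofReal (Real.exp (-(lam * L))) * f x *
              ∑' n : ℕ, ENNReal.ofReal lam ^ (n + 1) * hfun f n x /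
                (Nat.factorial (n + 1) : ℝ≥0∞)) := by
    intro x hx
    unfold pdens
    rw [← hL, mul_assoc, mul_left_comm]
    gcongr
    rw [hexp, ← tsum_Ssum]
    gcongr with n
    exact iterConv_le_Ssum hmeas hpos hint hq hfq hC1 hq1 hq2 n x hx
  have hlow : ∀ x : EuclideanSpace ℝ (Fin d),
      ENNReal.ofReal (Real.exp (-(lam * L))) * f x *
            ∑' n : ℕ, ENNReal.ofReal lam ^ (n + 1) * gfun f n x / (Nat.factorial (n + 1) : ℝ≥0∞)
              ≤ pdens f lam x := by
    intro x
    unfold pdens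
    rw [← hL, mul_assoc, ← ENNReal.tsum_mul_left]
    gcongr with n
    rw [← mul_div_assoc, mul_left_comm]
    gcongr
    exact mul_gfun_le n x
  refine ⟨fun x hx => ⟨?_, ?_⟩, fun x hx => ⟨⟨?_, hup x hx⟩, hlow x, ?_⟩⟩
  · unfold pdens
    rw [← hL, mul_comm lam, ENNReal.ofReal_mul (Real.exp_pos _).le, mul_assoc]
    gcongr
    refine le_trans ?_ (ENNReal.le_tsum 0)
    simp [iterConv]
  · unfold pdens
    rw [← hL, show (M₂ - L) * lam = -(lam * L) + M₂ * lam by ring, Real.exp_add, mul_assoc,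
      ENNReal.ofReal_mul (Real.exp_pos _).le, ENNReal.ofReal_mul (Real.exp_pos _).le, mul_assoc]
    gcongr
    rw [hexp, mul_assoc, ← ENNReal.tsum_mul_right]
    refine ENNReal.tsum_le_tsum fun n => ?_
    have h1 := iterConv_le_small hmeas hq hfq hC1 hq2 n ‖x‖ x (norm_nonneg _) (by linarith) le_rfl
    rw [← hfq] at h1
    have hc : ((n + 1 : ℕ) : ℝ≥0∞) * ((n + 1).factorial : ℝ≥0∞)⁻¹ = (n.factorial : ℝ≥0∞)⁻¹ := by
      rw [Nat.factorial_succ, Nat.cast_mul, ENNReal.mul_inv (Or.inr (ENNReal.natCast_ne_top _))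
        (Or.inl (ENNReal.natCast_ne_top _)), ← mul_assoc, ENNReal.mul_inv_cancel
        (by exact_mod_cast n.succ_ne_zero) (ENNReal.natCast_ne_top _), one_mul]
    calc _ ≤ ENNReal.ofReal lam ^ (n + 1) * ((n + 1 : ℕ) * (C * ∫⁻ y, f y) ^ n * f x) /
          ((n + 1).factorial : ℝ≥0∞) := by gcongr
      _ = ((n + 1 : ℕ) : ℝ≥0∞) * ((n + 1).factorial : ℝ≥0∞)⁻¹ *
          (ENNReal.ofReal lam ^ (n + 1) * (C * ∫⁻ y, f y) ^ n * f x) := by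
          rw [div_eq_mul_inv]; ring
      _ = _ := by rw [hc, div_eq_mul_inv]; ring
  · refine le_trans ?_ (hlow x)
    gcongr with n
    exact hfun_le_gfun _ x
  · refine (hup x hx).trans ?_
    gcongr with n
    exact hfun_le_gfun _ x
end
end

section
/- Let f : ℝ^d → (0,∞] be a radial decreasing density satisfying, for a constant C₁ ≥ 1, f(x) ≤ C₁ f(y) whenever 1 ≤ |x| ≤ |y| ≤ |x|+1. Then for every n ∈ ℕ and all x, y ∈ ℝ^d with 1 ≤ |x| ≤ |y| ≤ |x|+1 one has h_n(x) f(x) ≤ C₁ h_n(y) f(y). -/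
open MeasureTheory Filter Topology ENNReal Set

noncomputable section

lemma hfun_isom {d : ℕ} (f : EuclideanSpace ℝ (Fin d) → ℝ≥0∞)
    (q : ℝ → ℝ≥0∞) (hfq : ∀ x, f x = q ‖x‖)
    (R : EuclideanSpace ℝ (Fin d) ≃ₗᵢ[ℝ] EuclideanSpace ℝ (Fin d)) :
    ∀ (n : ℕ) (x : EuclideanSpace ℝ (Fin d)), hfun f n (R x) = hfun f n x := by
  have hf : ∀ x, f (R x) = f x := fun x => by rw [hfq, hfq, R.norm_map]
  intro n
  induction n with
  | zero => intro x; rfl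
  | succ n ih =>
    intro x
    have hD : R ⁻¹' (Dset (R x)) = Dset x := by
      ext z
      simp only [Dset, Set.mem_preimage, Set.mem_ofPred_eq, ← map_sub, R.norm_map]
    simp only [hfun]
    rw [hf, ← R.measurePreserving.setLIntegral_comp_preimage_emb
      R.toHomeomorph.measurableEmbedding, hD]
    simp only [← map_sub, hf, ih]

lemma hfun_radial {d : ℕ} (f : EuclideanSpace ℝ (Fin d) → ℝ≥0∞)
    (q : ℝ → ℝ≥0∞) (hfq : ∀ x, f x = q ‖x‖) (n : ℕ)
    (x y : EuclideanSpace ℝ (Fin d)) (h : ‖x‖ = ‖y‖) : hfun f n x = hfun f n y := by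
  have := hfun_isom f q hfq (Submodule.reflection (ℝ ∙ (x - y))ᗮ) n x
  rw [Submodule.reflection_sub h] at this
  exact this.symm

/-- If `f` is a radial decreasing density with `f(x) ≤ C₁ f(y)` whenever
`1 ≤ |x| ≤ |y| ≤ |x|+1` (`C₁ ≥ 1`), then for every `n ≥ 1` (written `n+1`) and all such
`x, y` one has `h_n(x) f(x) ≤ C₁ h_n(y) f(y)`. -/
theorem stmt3 (d : ℕ) (hd : 0 < d) (f : EuclideanSpace ℝ (Fin d) → ℝ≥0∞)
    (hmeas : Measurable f) (hpos : ∀ x, 0 < f x) (hint : ∫⁻ x, f x ≠ ⊤)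
    (q : ℝ → ℝ≥0∞) (hq : Antitone q) (hfq : ∀ x, f x = q ‖x‖)
    (C₁ : ℝ) (hC₁ : 1 ≤ C₁)
    (hC1f : ∀ x y : EuclideanSpace ℝ (Fin d), 1 ≤ ‖x‖ → ‖x‖ ≤ ‖y‖ → ‖y‖ ≤ ‖x‖ + 1 →
      f x ≤ ENNReal.ofReal C₁ * f y) :
    ∀ (n : ℕ) (x y : EuclideanSpace ℝ (Fin d)), 1 ≤ ‖x‖ → ‖x‖ ≤ ‖y‖ → ‖y‖ ≤ ‖x‖ + 1 →
      hfun f n x * f x ≤ ENNReal.ofReal C₁ * (hfun f n y * f y) := by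
  have hbase : ∀ (n : ℕ) (x y : EuclideanSpace ℝ (Fin d)), 1 ≤ ‖x‖ → ‖x‖ ≤ ‖y‖ →
      ‖y‖ ≤ ‖x‖ + 1 → ‖y - x‖ = ‖y‖ - ‖x‖ →
      hfun f n x * f x ≤ ENNReal.ofReal C₁ * (hfun f n y * f y) := by
    intro n x y hx hxy hyx hd'
    cases n with
    | zero => simpa [hfun] using hC1f x y hx hxy hyx
    | succ n =>
      have hfy : f y ≠ ⊤ := by
        intro htop
        apply hint
        rw [eq_top_iff]
        have hb : ∀ z ∈ Metric.ball (0 : EuclideanSpace ℝ (Fin d)) 1, f z = ⊤ := by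
          intro z hz
          rw [mem_ball_zero_iff] at hz
          rw [hfq] at htop ⊢
          rw [eq_top_iff, ← htop]
          exact hq (by linarith)
        calc (⊤ : ℝ≥0∞) = ∫⁻ z in Metric.ball (0 : EuclideanSpace ℝ (Fin d)) 1, ⊤ := by
              rw [setLIntegral_const, ENNReal.top_mul]
              exact (Metric.measure_ball_pos volume _ one_pos).ne'
          _ = ∫⁻ z in Metric.ball (0 : EuclideanSpace ℝ (Fin d)) 1, f z :=
              (setLIntegral_congr_fun measurableSet_ball hb).symm
          _ ≤ ∫⁻ z, f z := setLIntegral_le_lintegral _ _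
      simp only [hfun]
      rw [ENNReal.div_mul_cancel (hpos y).ne' hfy]
      have hC1' : (1 : ℝ≥0∞) ≤ ENNReal.ofReal C₁ := by simpa using hC₁
      have hmeasD : MeasurableSet (Dset x) := by
        have e : Dset x = Metric.ball 0 (‖x‖ - 1) ∩ Metric.ball x (‖x‖ - 1) := by
          ext z
          simp [Dset, dist_eq_norm, norm_sub_rev]
        rw [e]
        exact measurableSet_ball.inter measurableSet_ball
      have htri : ∀ z, ‖y - z‖ ≤ ‖x - z‖ + (‖y‖ - ‖x‖) := by
        intro z
        have : y - z = (x - z) + (y - x) := by abel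
        rw [this, ← hd']
        exact norm_add_le _ _
      have hsub : Dset x ⊆ Dset y := by
        rintro z ⟨h1, h2⟩
        exact ⟨by linarith, by linarith [htri z]⟩
      calc _ ≤ ∫⁻ z in Dset x, f (x - z) * f z * hfun f n z := by
            rw [mul_comm]; exact ENNReal.mul_div_le
        _ ≤ ∫⁻ z in Dset x, ENNReal.ofReal C₁ * (f (y - z) * f z * hfun f n z) := by
            apply setLIntegral_mono' hmeasD
            rintro z ⟨h1, h2⟩
            have h3 : 1 ≤ ‖x - z‖ := by linarith [norm_sub_norm_le x z]
            have key : f (x - z) ≤ ENNReal.ofReal C₁ * f (y - z) := by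
              rcases le_total ‖x - z‖ ‖y - z‖ with h | h
              · exact hC1f _ _ h3 h (by linarith [htri z])
              · calc f (x - z) ≤ f (y - z) := by rw [hfq, hfq]; exact hq h
                  _ ≤ _ := le_mul_of_one_le_left (zero_le) hC1'
            calc _ ≤ (ENNReal.ofReal C₁ * f (y - z)) * f z * hfun f n z := by gcongr
              _ = _ := by ring
        _ = ENNReal.ofReal C₁ * ∫⁻ z in Dset x, (f (y - z) * f z * hfun f n z) :=
            lintegral_const_mul' _ _ ENNReal.ofReal_ne_top
        _ ≤ _ := by gcongr
  intro n x y hx hxy hyx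
  have hx0 : ‖x‖ ≠ 0 := by linarith
  have hc : 0 ≤ ‖y‖ / ‖x‖ := by positivity
  have hny : ‖(‖y‖ / ‖x‖) • x‖ = ‖y‖ := by
    rw [norm_smul, Real.norm_of_nonneg hc]; field_simp
  have := hbase n x ((‖y‖ / ‖x‖) • x) hx (by rwa [hny]) (by rwa [hny]) (by
    have h1 : (‖y‖ / ‖x‖) • x - x = (‖y‖ / ‖x‖ - 1) • x := by rw [sub_smul, one_smul]
    have h2 : 0 ≤ ‖y‖ / ‖x‖ - 1 := by
      rw [sub_nonneg, le_div_iff₀ (by linarith)]; linarith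
    rw [h1, hny, norm_smul, Real.norm_of_nonneg h2]; field_simp)
  rwa [hfun_radial f q hfq n _ y hny, hfq (_ • x), hny, ← hfq] at this
end
end
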